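/- Transport chain identity for the mesoscopic energies: let ρ > 0, u, A, φ, J, ψ be smooth fields on an open set Ω ⊆ ℝ³ × ℝ satisfying the mass conservation equation ∂_t ρ + ∂_k(ρ u_k) = 0. Define the dual variables α_{ik} := ρ c_s² A_{ij} G̊_{jk}, γ_{ik} := ρ c_s² φ_{ij} D̊_{jk}, β_k := ρ c_h² J_k, ξ_k := ρ c_h² ψ_k. Then at every point of Ω: u_i[ ∂_t(ρ u_i) + ∂_k(ρ u_i u_k) ] + α_{ik}[ ∂_t A_{ik} + u_j ∂_j A_{ik} ] + γ_{ik}[ ∂_t φ_{ik} + u_j ∂_j φ_{ik} ] + β_k[ ∂_t J_k + u_j ∂_j J_k ] + ξ_k[ ∂_t ψ_k + u_j ∂_j ψ_k ] = ∂_t( E₂ + E₃ + E₄ + E₅ + E₆ ) + ∂_k( (E₂ + E₃ + E₄ + E₅ + E₆) u_k ). -/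

import Mathlib

/-!
Transport chain identity for the mesoscopic energies of the GLM GPR model.
-/

noncomputable section

open scoped BigOperators

/-- A space-time point: (spatial coordinates in ℝ³, time). -/
abbrev Pt : Type := (Fin 3 → ℝ) × ℝ

/-- Spatial partial derivative in the `k`-th coordinate direction. -/
def pd (k : Fin 3) (f : Pt → ℝ) (x : Pt) : ℝ :=
  fderiv ℝ f x ((Pi.single k 1 : Fin 3 → ℝ), (0 : ℝ))

/-- Time derivative. -/
def pdt (f : Pt → ℝ) (x : Pt) : ℝ :=
  fderiv ℝ f x ((0 : Fin 3 → ℝ), (1 : ℝ))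

/-- Trace-free (deviatoric) part of a 3×3 matrix. -/
def dev (M : Fin 3 → Fin 3 → ℝ) (i k : Fin 3) : ℝ :=
  M i k - (1 / 3) * (∑ m, M m m) * (if i = k then (1 : ℝ) else 0)

/-- Metric tensor `G = AᵀA` of a matrix field, at a point. -/
def Gm (A : Fin 3 → Fin 3 → Pt → ℝ) (x : Pt) (i k : Fin 3) : ℝ :=
  ∑ j, A j i x * A j k x

/-- Kinetic energy density `E₂ = ½ ρ |u|²`. -/
def E2 (ρ : Pt → ℝ) (u : Fin 3 → Pt → ℝ) (x : Pt) : ℝ :=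
  (1 / 2) * ρ x * ∑ i, u i x * u i x

/-- Mesoscopic energy density `E₃ = ¼ c_s² ρ G̊:G̊` (also `E₅` with `φ` in
place of `A`). -/
def E3 (cs : ℝ) (ρ : Pt → ℝ) (A : Fin 3 → Fin 3 → Pt → ℝ) (x : Pt) : ℝ :=
  (1 / 4) * cs ^ 2 * ρ x * ∑ i, ∑ k, dev (Gm A x) i k * dev (Gm A x) i k

/-- Energy density `E₄ = ½ c_h² ρ |J|²` (also `E₆` with `ψ` in place of `J`). -/
def E4 (ch : ℝ) (ρ : Pt → ℝ) (J : Fin 3 → Pt → ℝ) (x : Pt) : ℝ :=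
  (1 / 2) * ch ^ 2 * ρ x * ∑ k, J k x * J k x

/-- The material derivative is the derivative in the space-time direction `(a, 1)`. -/
theorem pdt_add_sum_mul_pd (f : Pt → ℝ) (a : Fin 3 → ℝ) (x : Pt) :
    pdt f x + ∑ j, a j * pd j f x = fderiv ℝ f x (a, 1) := by
  have h : ((a, 1) : Pt) = ((0 : Fin 3 → ℝ), (1 : ℝ))
      + ∑ j, a j • (((Pi.single j 1 : Fin 3 → ℝ), (0 : ℝ)) : Pt) := by
    ext k
    · fin_cases k <;> simp [Fin.sum_univ_three]
    · simp [Fin.sum_univ_three]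
  rw [h]
  simp only [pdt, pd, map_add, map_sum, map_smul, smul_eq_mul]

/-- Under mass conservation, the conservative transport operator applied to `ρ e` is `ρ` times the
material derivative of `e`. -/
theorem pdt_add_sum_pd_mul_of_mass {ρ e : Pt → ℝ} {u : Fin 3 → Pt → ℝ} {x : Pt}
    (hρ : DifferentiableAt ℝ ρ x) (he : DifferentiableAt ℝ e x)
    (hu : ∀ i, DifferentiableAt ℝ (u i) x)
    (hmass : pdt ρ x + ∑ k, pd k (fun y => ρ y * u k y) x = 0) :
    pdt (fun y => ρ y * e y) x + ∑ k, pd k (fun y => ρ y * e y * u k y) x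
      = ρ x * fderiv ℝ e x (fun i => u i x, 1) := by
  rw [← pdt_add_sum_mul_pd]
  have h (k : Fin 3) : pd k (fun y => ρ y * e y * u k y) x
      = e x * pd k (fun y => ρ y * u k y) x + ρ x * (u k x * pd k e x) := by
    simp only [pd]
    rw [fderiv_fun_mul (hρ.fun_mul he) (hu k), fderiv_fun_mul hρ he, fderiv_fun_mul hρ (hu k)]
    simp
    ring
  have ht : pdt (fun y => ρ y * e y) x = e x * pdt ρ x + ρ x * pdt e x := by
    simp only [pdt]
    rw [fderiv_fun_mul hρ he]
    simp
    ring
  simp only [h, ht, Finset.sum_add_distrib, ← Finset.mul_sum]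
  linear_combination e x * hmass

theorem hasFDerivAt_half_sum_sq {v : Fin 3 → Pt → ℝ} {x : Pt}
    (hv : ∀ i, DifferentiableAt ℝ (v i) x) :
    HasFDerivAt (fun y => (1 / 2) * ∑ i, v i y * v i y) (∑ i, v i x • fderiv ℝ (v i) x) x := by
  have h := (HasFDerivAt.fun_sum (u := Finset.univ) fun i _ =>
    (hv i).hasFDerivAt.fun_mul (hv i).hasFDerivAt).const_mul (1 / 2)
  refine h.congr_fderiv (ContinuousLinearMap.ext fun w => ?_)
  simp [Fin.sum_univ_three]
  ring

theorem hasFDerivAt_quarter_sum_dev_sq {A : Fin 3 → Fin 3 → Pt → ℝ} {x : Pt}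
    (hA : ∀ i k, DifferentiableAt ℝ (A i k) x) :
    HasFDerivAt (fun y => (1 / 4) * ∑ i, ∑ k, dev (Gm A y) i k * dev (Gm A y) i k)
      (∑ i, ∑ k, (∑ j, A i j x * dev (Gm A x) j k) • fderiv ℝ (A i k) x) x := by
  have hG (i k : Fin 3) := HasFDerivAt.fun_sum (u := Finset.univ) fun j _ =>
    (hA j i).hasFDerivAt.fun_mul (hA j k).hasFDerivAt
  have hdev (i k : Fin 3) := (hG i k).fun_sub
    (((HasFDerivAt.fun_sum (u := Finset.univ) fun m _ => hG m m).const_mul (1 / 3)).mul_const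
      (if i = k then (1 : ℝ) else 0))
  have h := (HasFDerivAt.fun_sum (u := Finset.univ) fun i _ =>
    HasFDerivAt.fun_sum (u := Finset.univ) fun k _ =>
      (hdev i k).fun_mul (hdev i k)).const_mul (1 / 4)
  refine h.congr_fderiv (ContinuousLinearMap.ext fun w => ?_)
  simp [Fin.sum_univ_three, dev, Gm]
  ring

/-- **Transport chain identity for the mesoscopic energies.**  If the smooth
fields satisfy mass conservation, then multiplying the time-derivative and
advection parts of the remaining equations by the thermodynamic dual variables
produces the exact transport form of `E₂ + E₃ + E₄ + E₅ + E₆`. -/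
theorem gpr_transport_chain_identity
    (Ω : Set Pt) (hΩ : IsOpen Ω)
    (cs ch : ℝ) (hcs : 0 ≤ cs) (hch : 0 ≤ ch)
    (ρ : Pt → ℝ) (u J ψ : Fin 3 → Pt → ℝ) (A φ : Fin 3 → Fin 3 → Pt → ℝ)
    (hρ : ContDiffOn ℝ (⊤ : ℕ∞) ρ Ω) (hρpos : ∀ x ∈ Ω, 0 < ρ x)
    (hu : ∀ i, ContDiffOn ℝ (⊤ : ℕ∞) (u i) Ω)
    (hJ : ∀ k, ContDiffOn ℝ (⊤ : ℕ∞) (J k) Ω)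
    (hψ : ∀ k, ContDiffOn ℝ (⊤ : ℕ∞) (ψ k) Ω)
    (hA : ∀ i k, ContDiffOn ℝ (⊤ : ℕ∞) (A i k) Ω)
    (hφ : ∀ i k, ContDiffOn ℝ (⊤ : ℕ∞) (φ i k) Ω)
    -- mass conservation
    (hmass : ∀ x ∈ Ω,
      pdt ρ x + ∑ k, pd k (fun y => ρ y * u k y) x = 0) :
    ∀ x ∈ Ω,
      -- u_i [∂_t(ρu_i) + ∂_k(ρ u_i u_k)]
      (∑ i, u i x *
          (pdt (fun y => ρ y * u i y) x
            + ∑ k, pd k (fun y => ρ y * u i y * u k y) x))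
      -- + α_{ik} [∂_t A_{ik} + u_j ∂_j A_{ik}]
      + (∑ i, ∑ k, (ρ x * cs ^ 2 * ∑ j, A i j x * dev (Gm A x) j k) *
          (pdt (A i k) x + ∑ j, u j x * pd j (A i k) x))
      -- + γ_{ik} [∂_t φ_{ik} + u_j ∂_j φ_{ik}]
      + (∑ i, ∑ k, (ρ x * cs ^ 2 * ∑ j, φ i j x * dev (Gm φ x) j k) *
          (pdt (φ i k) x + ∑ j, u j x * pd j (φ i k) x))
      -- + β_k [∂_t J_k + u_j ∂_j J_k]
      + (∑ k, (ρ x * ch ^ 2 * J k x) *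
          (pdt (J k) x + ∑ j, u j x * pd j (J k) x))
      -- + ξ_k [∂_t ψ_k + u_j ∂_j ψ_k]
      + (∑ k, (ρ x * ch ^ 2 * ψ k x) *
          (pdt (ψ k) x + ∑ j, u j x * pd j (ψ k) x))
      =
      pdt (fun y => E2 ρ u y + E3 cs ρ A y + E4 ch ρ J y
          + E3 cs ρ φ y + E4 ch ρ ψ y) x
        + ∑ k, pd k (fun y =>
            (E2 ρ u y + E3 cs ρ A y + E4 ch ρ J y
              + E3 cs ρ φ y + E4 ch ρ ψ y) * u k y) x := by
  intro x hx
  have diff {f : Pt → ℝ} (hf : ContDiffOn ℝ (⊤ : ℕ∞) f Ω) : DifferentiableAt ℝ f x :=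
    (hf.contDiffAt (hΩ.mem_nhds hx)).differentiableAt (by simp)
  have dρ := diff hρ
  have du i := diff (hu i)
  have he := ((((hasFDerivAt_half_sum_sq du).fun_add
    ((hasFDerivAt_quarter_sum_dev_sq fun i k => diff (hA i k)).const_mul (cs ^ 2))).fun_add
    ((hasFDerivAt_half_sum_sq fun k => diff (hJ k)).const_mul (ch ^ 2))).fun_add
    ((hasFDerivAt_quarter_sum_dev_sq fun i k => diff (hφ i k)).const_mul (cs ^ 2))).fun_add
    ((hasFDerivAt_half_sum_sq fun k => diff (hψ k)).const_mul (ch ^ 2))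
  have key := pdt_add_sum_pd_mul_of_mass dρ he.differentiableAt du (hmass x hx)
  have hE (y : Pt) : E2 ρ u y + E3 cs ρ A y + E4 ch ρ J y + E3 cs ρ φ y + E4 ch ρ ψ y
      = ρ y * ((1 / 2) * (∑ i, u i y * u i y)
        + cs ^ 2 * ((1 / 4) * ∑ i, ∑ k, dev (Gm A y) i k * dev (Gm A y) i k)
        + ch ^ 2 * ((1 / 2) * ∑ k, J k y * J k y)
        + cs ^ 2 * ((1 / 4) * ∑ i, ∑ k, dev (Gm φ y) i k * dev (Gm φ y) i k)
        + ch ^ 2 * ((1 / 2) * ∑ k, ψ k y * ψ k y)) := by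
    simp only [E2, E3, E4]
    ring
  simp only [hE]
  rw [key, he.fderiv]
  simp only [fun i => pdt_add_sum_pd_mul_of_mass dρ (du i) du (hmass x hx),
    fun f => pdt_add_sum_mul_pd f (fun i => u i x) x]
  simp only [add_apply, smul_apply, sum_apply, smul_eq_mul, mul_add,
    Finset.mul_sum, mul_assoc, mul_left_comm, Finset.sum_mul]
  ring
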